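/- Let σ ∈ ℤ with σ ≥ 1, let ℓ, ℓ′ ∈ (σ/2)·ℤ both nonzero, let c, c′ ∈ ℤ, and let φ, ψ : ℝ → ℂ be Schwartz functions. Then the integral ∫₀¹ ∫₀¹ ∫₀^{2/σ} Θ_{ℓ,c}(φ)(x+iy, r) · conj(Θ_{ℓ′,c′}(ψ)(x+iy, r)) dr dy dx equals (2/σ) · ∫_ℝ φ(ξ) · conj(ψ(ξ)) dξ if ℓ = ℓ′ and (c − c′)/(2ℓ) ∈ ℤ, and equals 0 otherwise. -/

import Mathlib

open MeasureTheory

/-- The theta function `Θ_{ℓ,c}(φ)(n(x+iy,r))`, as a function of `(x,y,r) ∈ ℝ³`. -/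
noncomputable def thetaFun (ℓ c : ℝ) (φ : ℝ → ℂ) (x y r : ℝ) : ℂ :=
  ∑' k : ℤ,
    Complex.exp (((2 * Real.pi * ℓ * (r - x * (c / ℓ + 2 * (k : ℝ) + y)) : ℝ) : ℂ) *
        Complex.I) *
      φ (c / (2 * ℓ) + (k : ℝ) + y)

/-- The unitary character `t ↦ exp (2πit)` of `ℝ`. -/
noncomputable def unitPhase (t : ℝ) : ℂ :=
  Complex.exp (((2 * Real.pi * t : ℝ) : ℂ) * Complex.I)

lemma unitPhase_zero : unitPhase 0 = 1 := by simp [unitPhase]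

lemma unitPhase_add (s t : ℝ) : unitPhase (s + t) = unitPhase s * unitPhase t := by
  rw [unitPhase, unitPhase, unitPhase, ← Complex.exp_add]
  congr 1
  push_cast
  ring

lemma norm_unitPhase (t : ℝ) : ‖unitPhase t‖ = 1 := Complex.norm_exp_ofReal_mul_I _

lemma conj_unitPhase (t : ℝ) : (starRingEnd ℂ) (unitPhase t) = unitPhase (-t) := by
  rw [unitPhase, unitPhase, ← Complex.exp_conj]
  congr 1
  simp only [map_mul, Complex.conj_ofReal, Complex.conj_I]
  push_cast
  ring

lemma continuous_unitPhase : Continuous unitPhase := by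
  unfold unitPhase
  fun_prop

lemma unitPhase_intCast (n : ℤ) : unitPhase n = 1 := by
  rw [unitPhase, Complex.exp_eq_one_iff]
  exact ⟨n, by push_cast; ring⟩

lemma integral_unitPhase_mul_eq_zero {a T : ℝ} (ha : a ≠ 0) (n : ℤ) (hn : a * T = n) :
    ∫ t in (0 : ℝ)..T, unitPhase (a * t) = 0 := by
  have hc : (2 * Real.pi * a * Complex.I : ℂ) ≠ 0 := by
    simp [ha, Real.pi_ne_zero]
  have h : ∀ t : ℝ, unitPhase (a * t) = Complex.exp (2 * Real.pi * a * Complex.I * t) := by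
    intro t
    rw [unitPhase]
    congr 1
    push_cast
    ring
  simp_rw [h]
  rw [integral_exp_mul_complex hc, ← h, ← h, hn, unitPhase_intCast, mul_zero, unitPhase_zero,
    sub_self, zero_div]

/-- Termwise integration over `[0,1]` of a series dominated by a convergent series of constants. -/
lemma hasSum_integral_zero_one_of_norm_le {ι : Type*} [Countable ι] {F : ι → ℝ → ℂ} {f : ℝ → ℂ}
    {u : ι → ℝ} (hF : ∀ i, Continuous (F i)) (hu : Summable u)
    (hFu : ∀ i, ∀ t ∈ Set.Icc (0 : ℝ) 1, ‖F i t‖ ≤ u i)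
    (hf : ∀ t ∈ Set.Icc (0 : ℝ) 1, HasSum (fun i => F i t) (f t)) :
    HasSum (fun i => ∫ t in (0 : ℝ)..1, F i t) (∫ t in (0 : ℝ)..1, f t) := by
  have hI : ∀ t : ℝ, t ∈ Set.uIoc (0 : ℝ) 1 → t ∈ Set.Icc (0 : ℝ) 1 := by
    intro t ht
    rw [Set.uIoc_of_le zero_le_one] at ht
    exact Set.Ioc_subset_Icc_self ht
  refine intervalIntegral.hasSum_integral_of_dominated_convergence (fun i _ => u i)
    (fun i => (hF i).aestronglyMeasurable) (fun i => ?_) ?_ ?_ ?_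
  · exact Filter.Eventually.of_forall fun t ht => hFu i t (hI t ht)
  · exact Filter.Eventually.of_forall fun t _ => hu
  · exact intervalIntegrable_const
  · exact Filter.Eventually.of_forall fun t ht => hf t (hI t ht)

/-- The integer translates of a Schwartz function are uniformly summable on `[0,1]`. -/
lemma SchwartzMap.exists_summable_bound_int_translates (φ : SchwartzMap ℝ ℂ) (a : ℝ) :
    ∃ u : ℤ → ℝ, Summable u ∧ (∀ k, 0 ≤ u k) ∧
      ∀ k : ℤ, ∀ y ∈ Set.Icc (0 : ℝ) 1, ‖φ (a + k + y)‖ ≤ u k := by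
  obtain ⟨C, hC⟩ : ∃ C : ℝ, ∀ t : ℝ, (1 + |t|) ^ 2 * ‖φ t‖ ≤ C :=
    ⟨_, fun t => by
      simpa using SchwartzMap.one_add_le_sup_seminorm_apply (𝕜 := ℝ) (m := (2, 0)) (k := 2)
        (n := 0) le_rfl le_rfl φ t⟩
  have hC0 : 0 ≤ C := le_trans (by positivity) (hC 0)
  refine ⟨fun k => C * (|a| + 2) ^ 2 * (1 / |(k : ℝ) + 1 / 2| ^ (2 : ℝ)), ?_, ?_, ?_⟩
  · exact ((Real.summable_one_div_int_add_rpow (1 / 2) 2).2 one_lt_two).mul_left _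
  · intro k
    positivity
  · intro k y hy
    obtain ⟨hy0, hy1⟩ := hy
    have hk : (k : ℝ) + 1 / 2 ≠ 0 := by
      intro h
      have h2 : ((2 * k + 1 : ℤ) : ℝ) = 0 := by push_cast; linarith
      have h3 : 2 * k + 1 = 0 := by exact_mod_cast h2
      omega
    have hk0 : 0 < |(k : ℝ) + 1 / 2| := abs_pos.2 hk
    set t : ℝ := a + k + y with ht
    have hle : |(k : ℝ) + 1 / 2| ≤ (|a| + 2) * (1 + |t|) := by
      have h1 : |(k : ℝ) + 1 / 2| ≤ |t| + |a| + 1 := by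
        rw [abs_le]
        constructor <;>
          linarith [le_abs_self t, neg_abs_le t, le_abs_self a, neg_abs_le a]
      nlinarith [mul_nonneg (abs_nonneg a) (abs_nonneg t), abs_nonneg a, abs_nonneg t]
    simp only [Real.rpow_two]
    rw [mul_one_div, le_div_iff₀ (by positivity)]
    calc ‖φ t‖ * |(k : ℝ) + 1 / 2| ^ 2 ≤ ‖φ t‖ * ((|a| + 2) * (1 + |t|)) ^ 2 := by gcongr
      _ = (1 + |t|) ^ 2 * ‖φ t‖ * (|a| + 2) ^ 2 := by ring
      _ ≤ C * (|a| + 2) ^ 2 := by gcongr; exact hC t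

lemma thetaFun_eq_unitPhase_mul {ℓ : ℝ} (c : ℝ) (φ : ℝ → ℂ) (x y r : ℝ) :
    thetaFun ℓ c φ x y r = unitPhase (ℓ * r) * thetaFun ℓ c φ x y 0 := by
  rw [thetaFun, thetaFun, ← tsum_mul_left]
  congr 1 with k
  rw [← mul_assoc, unitPhase, ← Complex.exp_add]
  congr 2
  push_cast
  ring

lemma summable_norm_unitPhase_mul_translates (φ : SchwartzMap ℝ ℂ) (a : ℝ) (s : ℤ → ℝ) {y : ℝ}
    (hy : y ∈ Set.Icc (0 : ℝ) 1) :
    Summable fun k : ℤ => ‖unitPhase (s k) * φ (a + k + y)‖ := by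
  obtain ⟨u, hu, -, hb⟩ := φ.exists_summable_bound_int_translates a
  refine hu.of_nonneg_of_le (fun _ => norm_nonneg _) fun k => ?_
  rw [norm_mul, norm_unitPhase, one_mul]
  exact hb k y hy

lemma thetaFun_eq_tsum_unitPhase (ℓ c : ℝ) (φ : ℝ → ℂ) (x y : ℝ) :
    thetaFun ℓ c φ x y 0 = ∑' k : ℤ,
      unitPhase (ℓ * (0 - x * (c / ℓ + 2 * (k : ℝ) + y))) * φ (c / (2 * ℓ) + k + y) := by
  simp only [thetaFun, unitPhase, mul_assoc]

lemma hasSum_thetaFun_mul_conj {ℓ : ℝ} (hℓ : ℓ ≠ 0) (c c' : ℝ) (φ ψ : SchwartzMap ℝ ℂ)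
    (x : ℝ) {y : ℝ} (hy : y ∈ Set.Icc (0 : ℝ) 1) :
    HasSum (fun p : ℤ × ℤ => unitPhase (-(c - c' + 2 * ℓ * (p.1 - p.2)) * x) *
        (φ (c / (2 * ℓ) + p.1 + y) * (starRingEnd ℂ) (ψ (c' / (2 * ℓ) + p.2 + y))))
      (thetaFun ℓ c φ x y 0 * (starRingEnd ℂ) (thetaFun ℓ c' ψ x y 0)) := by
  have hs := summable_norm_unitPhase_mul_translates φ (c / (2 * ℓ))
    (fun k => ℓ * (0 - x * (c / ℓ + 2 * (k : ℝ) + y))) hy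
  have hs' : Summable fun k : ℤ => ‖(starRingEnd ℂ)
      (unitPhase (ℓ * (0 - x * (c' / ℓ + 2 * (k : ℝ) + y))) * ψ (c' / (2 * ℓ) + k + y))‖ := by
    simp_rw [RCLike.norm_conj]
    exact summable_norm_unitPhase_mul_translates ψ _ _ hy
  rw [thetaFun_eq_tsum_unitPhase, thetaFun_eq_tsum_unitPhase, Complex.conj_tsum,
    tsum_mul_tsum_of_summable_norm hs hs']
  refine (summable_mul_of_summable_norm hs hs').hasSum.congr_fun fun p => ?_
  have hphase : -(c - c' + 2 * ℓ * (p.1 - p.2)) * x =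
      ℓ * (0 - x * (c / ℓ + 2 * p.1 + y)) + -(ℓ * (0 - x * (c' / ℓ + 2 * p.2 + y))) := by
    field_simp
    ring
  rw [map_mul, conj_unitPhase, mul_mul_mul_comm, ← unitPhase_add, hphase]

lemma hasSum_integral_thetaFun_mul_conj {ℓ : ℝ} (hℓ : ℓ ≠ 0) {m : ℤ} (hm : 2 * ℓ = m)
    (c c' : ℤ) (φ ψ : SchwartzMap ℝ ℂ) :
    HasSum (fun p : ℤ × ℤ => if ((c : ℝ) - c' + 2 * ℓ * (p.1 - p.2)) = 0 then
        ∫ y in (0 : ℝ)..1,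
          φ (c / (2 * ℓ) + p.1 + y) * (starRingEnd ℂ) (ψ (c' / (2 * ℓ) + p.2 + y)) else 0)
      (∫ x in (0 : ℝ)..1, ∫ y in (0 : ℝ)..1,
        thetaFun ℓ c φ x y 0 * (starRingEnd ℂ) (thetaFun ℓ c' ψ x y 0)) := by
  obtain ⟨u, hu, hu0, hφ⟩ := φ.exists_summable_bound_int_translates (c / (2 * ℓ))
  obtain ⟨v, hv, hv0, hψ⟩ := ψ.exists_summable_bound_int_translates (c' / (2 * ℓ))
  have huv : Summable fun p : ℤ × ℤ => u p.1 * v p.2 := hu.mul_of_nonneg hv hu0 hv0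
  have hbound : ∀ p : ℤ × ℤ, ∀ y ∈ Set.Icc (0 : ℝ) 1,
      ‖φ (c / (2 * ℓ) + p.1 + y) * (starRingEnd ℂ) (ψ (c' / (2 * ℓ) + p.2 + y))‖
        ≤ u p.1 * v p.2 := by
    intro p y hy
    rw [norm_mul, RCLike.norm_conj]
    exact mul_le_mul (hφ _ y hy) (hψ _ y hy) (norm_nonneg _) (hu0 _)
  have hcont : ∀ p : ℤ × ℤ, Continuous fun y : ℝ =>
      φ (c / (2 * ℓ) + p.1 + y) * (starRingEnd ℂ) (ψ (c' / (2 * ℓ) + p.2 + y)) := by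
    intro p
    have := φ.continuous
    have := ψ.continuous
    have := Complex.continuous_conj
    fun_prop
  have hy : ∀ x : ℝ, HasSum (fun p : ℤ × ℤ => unitPhase (-(c - c' + 2 * ℓ * (p.1 - p.2)) * x) *
      ∫ y in (0 : ℝ)..1,
        φ (c / (2 * ℓ) + p.1 + y) * (starRingEnd ℂ) (ψ (c' / (2 * ℓ) + p.2 + y)))
      (∫ y in (0 : ℝ)..1, thetaFun ℓ c φ x y 0 * (starRingEnd ℂ) (thetaFun ℓ c' ψ x y 0)) := by
    intro x
    simp_rw [← intervalIntegral.integral_const_mul]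
    refine hasSum_integral_zero_one_of_norm_le (fun p => (hcont p).const_mul _) huv ?_
      fun y hy => hasSum_thetaFun_mul_conj hℓ c c' φ ψ x hy
    intro p y hy
    rw [norm_mul, norm_unitPhase, one_mul]
    exact hbound p y hy
  have hcont' : ∀ p : ℤ × ℤ, Continuous fun x : ℝ =>
      unitPhase (-(c - c' + 2 * ℓ * (p.1 - p.2)) * x) * ∫ y in (0 : ℝ)..1,
        φ (c / (2 * ℓ) + p.1 + y) * (starRingEnd ℂ) (ψ (c' / (2 * ℓ) + p.2 + y)) :=
    fun p => (continuous_unitPhase.comp (continuous_const_mul _)).mul continuous_const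
  have hx := hasSum_integral_zero_one_of_norm_le hcont' huv (fun p x _ => ?_) fun x _ => hy x
  · refine hx.congr_fun fun p => ?_
    rw [intervalIntegral.integral_mul_const]
    split_ifs with h
    · simp [h, unitPhase_zero]
    · rw [integral_unitPhase_mul_eq_zero (neg_ne_zero.2 h) (-(c - c' + m * (p.1 - p.2))), zero_mul]
      rw [hm]
      push_cast
      ring
  · rw [norm_mul, norm_unitPhase, one_mul]
    simpa using intervalIntegral.norm_integral_le_of_norm_le_const (a := 0) (b := 1)
      fun y hy => hbound p y (by
        rw [Set.uIoc_of_le zero_le_one] at hy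
        exact Set.Ioc_subset_Icc_self hy)

/-- Orthogonality of theta functions over a fundamental domain
`[0,1]×[0,1]×[0,2/σ]` of the standard lattice `Λ_σ`:
`(Θ_{ℓ,c}(φ), Θ_{ℓ′,c′}(ψ)) = (2/σ)(φ,ψ)` if `ℓ = ℓ′` and `c ≡ c′ mod 2ℓ`, and `= 0`
otherwise. -/
theorem stmt_8 (σ : ℤ) (hσ : 1 ≤ σ) (ℓ ℓ' : ℝ)
    (hmem : ∃ k : ℤ, ℓ = (σ : ℝ) / 2 * k) (hmem' : ∃ k : ℤ, ℓ' = (σ : ℝ) / 2 * k)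
    (hℓ : ℓ ≠ 0) (hℓ' : ℓ' ≠ 0) (c c' : ℤ) (φ ψ : SchwartzMap ℝ ℂ) :
    ((ℓ = ℓ' ∧ ∃ k : ℤ, ((c : ℝ) - (c' : ℝ)) = 2 * ℓ * (k : ℝ)) →
      (∫ x in (0:ℝ)..1, ∫ y in (0:ℝ)..1, ∫ r in (0:ℝ)..(2 / (σ : ℝ)),
          thetaFun ℓ (c : ℝ) (⇑φ) x y r *
            (starRingEnd ℂ) (thetaFun ℓ' (c' : ℝ) (⇑ψ) x y r))
        = ((2 / (σ : ℝ) : ℝ) : ℂ) * ∫ ξ : ℝ, φ ξ * (starRingEnd ℂ) (ψ ξ)) ∧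
    (¬(ℓ = ℓ' ∧ ∃ k : ℤ, ((c : ℝ) - (c' : ℝ)) = 2 * ℓ * (k : ℝ)) →
      (∫ x in (0:ℝ)..1, ∫ y in (0:ℝ)..1, ∫ r in (0:ℝ)..(2 / (σ : ℝ)),
          thetaFun ℓ (c : ℝ) (⇑φ) x y r *
            (starRingEnd ℂ) (thetaFun ℓ' (c' : ℝ) (⇑ψ) x y r))
        = 0) := by
  have hσ0 : (σ : ℝ) ≠ 0 := by
    have : σ ≠ 0 := by omega
    exact_mod_cast this
  by_cases heq : ℓ = ℓ'
  · subst heq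
    obtain ⟨n, hn⟩ := hmem
    have hm : 2 * ℓ = ((σ * n : ℤ) : ℝ) := by
      rw [hn]
      push_cast
      ring
    have hr : ∀ x y r : ℝ, thetaFun ℓ c φ x y r * (starRingEnd ℂ) (thetaFun ℓ c' ψ x y r)
        = thetaFun ℓ c φ x y 0 * (starRingEnd ℂ) (thetaFun ℓ c' ψ x y 0) := by
      intro x y r
      rw [thetaFun_eq_unitPhase_mul, thetaFun_eq_unitPhase_mul (c' : ℝ) ψ x y r, map_mul,
        conj_unitPhase, mul_mul_mul_comm, ← unitPhase_add, add_neg_cancel, unitPhase_zero, one_mul]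
    simp_rw [hr, intervalIntegral.integral_const, sub_zero, intervalIntegral.integral_smul,
      Complex.real_smul]
    have hsum := hasSum_integral_thetaFun_mul_conj hℓ hm c c' φ ψ
    constructor
    · rintro ⟨-, m, hcm⟩
      congr 1
      have hinj : Function.Injective fun k : ℤ => (k, k + m) := fun a b h => congrArg Prod.fst h
      refine ((hinj.hasSum_iff ?_).2 hsum).unique ?_
      · rintro ⟨k, k'⟩ hp
        rw [if_neg]
        intro h
        refine hp ⟨k, Prod.ext rfl ?_⟩
        have h2 : 2 * ℓ * (m + k - k') = 0 := by linear_combination h - hcm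
        have h3 : (m + k - k' : ℝ) = 0 := by simpa [hℓ] using h2
        have h4 : m + k - k' = 0 := by exact_mod_cast h3
        change k + m = k'
        omega
      · have hint : Integrable fun t : ℝ => φ t * (starRingEnd ℂ) (ψ t) := by
          exact (φ.memLp 2 volume).integrable_mul (ψ.memLp 2 volume).star
        have h := (hint.comp_add_left (c / (2 * ℓ))).hasSum_intervalIntegral_comp_add_int
        rw [integral_add_left_eq_self (fun t => φ t * (starRingEnd ℂ) (ψ t))] at h
        refine h.congr_fun fun k => ?_
        have hc : (c' : ℝ) / (2 * ℓ) = c / (2 * ℓ) - m := by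
          field_simp
          linear_combination -hcm
        rw [Function.comp_apply, if_pos (by push_cast; linear_combination hcm), hc]
        refine intervalIntegral.integral_congr fun y _ => ?_
        have h1 : (c : ℝ) / (2 * ℓ) + (y + k) = c / (2 * ℓ) + k + y := by ring
        have h2 : (c : ℝ) / (2 * ℓ) - m + ((k + m : ℤ) : ℝ) + y = c / (2 * ℓ) + k + y := by
          push_cast
          ring
        simp only [h1, h2]
    · intro hne
      have h0 : ∀ p : ℤ × ℤ, ((c : ℝ) - c' + 2 * ℓ * (p.1 - p.2)) ≠ 0 := fun p hp =>
        hne ⟨trivial, p.2 - p.1, by push_cast; linear_combination hp⟩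
      simp only [h0, if_false] at hsum
      rw [hsum.unique hasSum_zero, mul_zero]
  · obtain ⟨n, hn⟩ := hmem
    obtain ⟨n', hn'⟩ := hmem'
    refine ⟨fun h => absurd h.1 heq, fun _ => ?_⟩
    have hr : ∀ x y : ℝ, ∫ r in (0 : ℝ)..(2 / (σ : ℝ)),
        thetaFun ℓ c φ x y r * (starRingEnd ℂ) (thetaFun ℓ' c' ψ x y r) = 0 := by
      intro x y
      have h : ∀ r : ℝ, thetaFun ℓ c φ x y r * (starRingEnd ℂ) (thetaFun ℓ' c' ψ x y r)
          = unitPhase ((ℓ - ℓ') * r) *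
            (thetaFun ℓ c φ x y 0 * (starRingEnd ℂ) (thetaFun ℓ' c' ψ x y 0)) := by
        intro r
        rw [thetaFun_eq_unitPhase_mul, thetaFun_eq_unitPhase_mul (c' : ℝ) ψ x y r, map_mul,
          conj_unitPhase, mul_mul_mul_comm, ← unitPhase_add]
        congr 2
        ring
      rw [intervalIntegral.integral_congr fun r _ => h r, intervalIntegral.integral_mul_const,
        integral_unitPhase_mul_eq_zero (sub_ne_zero.2 heq) (n - n'), zero_mul]
      rw [hn, hn']
      push_cast
      field_simp
    simp only [hr, intervalIntegral.integral_zero]
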